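/- Let G be a finite metric graph, let B be a set of vertices of G containing all boundary vertices and all proper core vertices of G, and let λ > 0 satisfy β₁(G_λ) = β₀^odd(G_λ). Then λ is an eigenvalue of −Δ_G if and only if λ is a pole of the Titchmarsh–Weyl function M_B, and moreover dim ker(−Δ_G − λ) = rank Res_λ M_B. -/

import Mathlib

open Real Set Filter Topology

noncomputable section

/-- A finite metric graph: finite vertex and edge sets, each edge `e` has an initial
vertex `o e`, a terminal vertex `t e` and a positive length `L e`, and is identified
with the interval `[0, L e]`.  Every vertex is an endpoint of some edge. -/
structure MetricGraph where
  V : Type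
  E : Type
  [fintV : Fintype V]
  [fintE : Fintype E]
  [decV : DecidableEq V]
  [decE : DecidableEq E]
  o : E → V
  t : E → V
  L : E → ℝ
  L_pos : ∀ e, 0 < L e
  noIsolated : ∀ v, ∃ e, o e = v ∨ t e = v

attribute [instance] MetricGraph.fintV MetricGraph.fintE MetricGraph.decV MetricGraph.decE

namespace MetricGraph

variable (G : MetricGraph)

/-- The source vertex of edge `e` traversed in direction `d`. -/
def esrc (e : G.E) (d : Bool) : G.V := if d then G.o e else G.t e

/-- The destination vertex of edge `e` traversed in direction `d`. -/
def edst (e : G.E) (d : Bool) : G.V := if d then G.t e else G.o e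

/-- A cycle in a metric graph: a closed walk which uses no edge twice and repeats no
vertex except that its initial and terminal vertices coincide. -/
structure Cycle where
  n : ℕ
  npos : 0 < n
  edge : Fin n → G.E
  dir : Fin n → Bool
  edge_inj : Function.Injective edge
  vert_inj : Function.Injective fun i => G.esrc (edge i) (dir i)
  chain : ∀ i : Fin n,
    G.edst (edge i) (dir i) =
      G.esrc (edge ⟨((i : ℕ) + 1) % n, Nat.mod_lt _ npos⟩)
        (dir ⟨((i : ℕ) + 1) % n, Nat.mod_lt _ npos⟩)

/-- The length of a cycle: the sum of the lengths of its edges. -/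
def Cycle.length {G : MetricGraph} (c : G.Cycle) : ℝ := ∑ i, G.L (c.edge i)

/-- The cycle `c` lies in the subgraph given by the edge set `S`. -/
def Cycle.inSub {G : MetricGraph} (c : G.Cycle) (S : Set G.E) : Prop := ∀ i, c.edge i ∈ S

/-- The cycle `c` has odd length with respect to `x`: its length is an odd multiple of `x`. -/
def Cycle.oddLength {G : MetricGraph} (c : G.Cycle) (x : ℝ) : Prop :=
  ∃ m : ℕ, Odd m ∧ c.length = m * x

/-- The initial vertex of a cycle. -/
def Cycle.start {G : MetricGraph} (c : G.Cycle) : G.V :=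
  G.esrc (c.edge ⟨0, c.npos⟩) (c.dir ⟨0, c.npos⟩)

/-- The vertices incident to an edge of the edge set `S`, i.e. the vertex set of the
subgraph generated by `S`. -/
def incVerts (S : Set G.E) : Set G.V := {v | ∃ e ∈ S, G.o e = v ∨ G.t e = v}

/-- Two vertices are related iff they are connected through edges of `S`. -/
def connRel (S : Set G.E) : G.V → G.V → Prop :=
  Relation.EqvGen fun v w => ∃ e ∈ S, G.o e = v ∧ G.t e = w

/-- The connected component of the vertex `v` in the subgraph given by `S`. -/
def component (S : Set G.E) (v : G.V) : Set G.V := {w | G.connRel S v w}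

/-- The number of connected components of the subgraph given by the edge set `S`. -/
def beta0 (S : Set G.E) : ℕ := (G.component S '' G.incVerts S).ncard

/-- The first Betti number `|E| - |V| + β₀` of the subgraph given by the edge set `S`. -/
def beta1 (S : Set G.E) : ℤ :=
  (S.ncard : ℤ) - ((G.incVerts S).ncard : ℤ) + (G.beta0 S : ℤ)

/-- The number of connected components of the subgraph given by `S` which contain a
cycle of odd length with respect to `x`. -/
def beta0odd (S : Set G.E) (x : ℝ) : ℕ :=
  (G.component S '' {v | v ∈ G.incVerts S ∧
    ∃ c : G.Cycle, c.inSub S ∧ c.oddLength x ∧ G.connRel S v c.start}).ncard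

/-- The edge set of the subgraph `G_λ`: all edges whose length is a positive integer
multiple of `π / √λ`. -/
def lamEdges (lam : ℝ) : Set G.E :=
  {e | ∃ k : ℕ, 0 < k ∧ G.L e = k * (π / Real.sqrt lam)}

/-- An edgewise given function is continuous at all the vertices of `G`. -/
def ContVert (f : G.E → ℝ → ℂ) : Prop :=
  (∀ e₁ e₂, G.o e₁ = G.o e₂ → f e₁ 0 = f e₂ 0) ∧
  (∀ e₁ e₂, G.o e₁ = G.t e₂ → f e₁ 0 = f e₂ (G.L e₂)) ∧
  (∀ e₁ e₂, G.t e₁ = G.t e₂ → f e₁ (G.L e₁) = f e₂ (G.L e₂))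

/-- The value of an (edgewise given, vertex-continuous) function at the vertex `v`. -/
def vtxVal (f : G.E → ℝ → ℂ) (v : G.V) : ℂ :=
  if h : ∃ e, G.o e = v then f h.choose 0
  else f (G.noIsolated v).choose (G.L ((G.noIsolated v).choose))

/-- `∂_ν f (v)`: the sum of the derivatives at the vertex `v` of the restrictions of
`f` to the edges incident to `v`, all pointing towards `v`. -/
def normDer (f : G.E → ℝ → ℂ) (v : G.V) : ℂ :=
  (∑ e ∈ Finset.univ.filter fun e => G.t e = v, deriv (f e) (G.L e)) -
    ∑ e ∈ Finset.univ.filter fun e => G.o e = v, deriv (f e) 0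

/-- `f` solves `-f'' = μ f` on every edge and is continuous at the vertices.
(A solution of `-f'' = μ f` on `[0, L e]` is identified with its unique extension to a
global solution on `ℝ`.) -/
def IsSol (mu : ℂ) (f : G.E → ℝ → ℂ) : Prop :=
  (∀ e, ContDiff ℝ 2 (f e)) ∧
  (∀ e, ∀ x : ℝ, deriv (deriv (f e)) x = -mu * f e x) ∧ G.ContVert f

/-- Membership in `ker (-Δ_G - λ)` for the Kirchhoff Laplacian `-Δ_G`. -/
def InKer (lam : ℝ) (f : G.E → ℝ → ℂ) : Prop :=
  G.IsSol (lam : ℂ) f ∧ ∀ v, G.normDer f v = 0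

/-- `ker (-Δ_G - λ)` as a set of (edgewise given) functions. -/
def kerSet (lam : ℝ) : Set (G.E → ℝ → ℂ) := {f | G.InKer lam f}

/-- `λ` is an eigenvalue of the Kirchhoff Laplacian `-Δ_G`. -/
def IsEigenvalue (lam : ℝ) : Prop := G.kerSet lam ≠ {0}

/-- `dim ker (-Δ_G - λ)`. -/
def dimKer (lam : ℝ) : ℕ := Module.finrank ℂ (Submodule.span ℂ (G.kerSet lam))

/-- The resonance eigenspace `R (G, λ)`: all elements of `ker (-Δ_G - λ)` vanishing at
every vertex of `G`. -/
def resSet (lam : ℝ) : Set (G.E → ℝ → ℂ) :=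
  {f | G.InKer lam f ∧ ∀ e, f e 0 = 0 ∧ f e (G.L e) = 0}

/-- `λ` is a (real) resonance of `G` iff `R (G, λ) ≠ {0}`. -/
def IsResonance (lam : ℝ) : Prop := G.resSet lam ≠ {0}

/-- `dim R (G, λ)`. -/
def dimRes (lam : ℝ) : ℕ := Module.finrank ℂ (Submodule.span ℂ (G.resSet lam))

/-- `R_B (G, λ)`: all elements of `ker (-Δ_G - λ)` vanishing at every vertex in `B`. -/
def resSetB (B : Set G.V) (lam : ℝ) : Set (G.E → ℝ → ℂ) :=
  {f | G.InKer lam f ∧ ∀ e, (G.o e ∈ B → f e 0 = 0) ∧ (G.t e ∈ B → f e (G.L e) = 0)}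

/-- `dim R_B (G, λ)`. -/
def dimResB (B : Set G.V) (lam : ℝ) : ℕ :=
  Module.finrank ℂ (Submodule.span ℂ (G.resSetB B lam))

/-- The degree of a vertex (a loop counts twice). -/
def degree (v : G.V) : ℕ := {e | G.o e = v}.ncard + {e | G.t e = v}.ncard

/-- The degree of a vertex inside the subgraph given by the edge set `S`. -/
def degreeIn (S : Set G.E) (v : G.V) : ℕ :=
  {e | e ∈ S ∧ G.o e = v}.ncard + {e | e ∈ S ∧ G.t e = v}.ncard

/-- The edge set of the core of `G`: the largest subgraph without vertices of degree one. -/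
def coreEdges : Set G.E := ⋃₀ {S : Set G.E | ∀ v, G.degreeIn S v ≠ 1}

/-- A boundary vertex is a vertex of degree one. -/
def IsBoundaryVertex (v : G.V) : Prop := G.degree v = 1

/-- A proper core vertex: all edges attached to it belong to the core of `G`. -/
def IsProperCoreVertex (v : G.V) : Prop :=
  ∀ e, G.o e = v ∨ G.t e = v → e ∈ G.coreEdges

/-- The defining property of the function `f^{(l)}` for the Titchmarsh--Weyl matrix:
`f` solves `-f'' = μ f` edgewise, is continuous at the vertices, and satisfies
`∂_ν f (v₀) = 1` and `∂_ν f (v) = 0` for all vertices `v ≠ v₀`. -/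
def IsTWsol (mu : ℂ) (v0 : G.V) (f : G.E → ℝ → ℂ) : Prop :=
  G.IsSol mu f ∧ G.normDer f v0 = 1 ∧ ∀ v, v ≠ v0 → G.normDer f v = 0

open scoped Classical in
/-- The Titchmarsh--Weyl matrix `M_B (μ)` with entries `(M_B (μ))_{k,l} = f^{(l)} (v_k)`
(defined via choice; junk if no `f^{(l)}` exists, i.e. at the eigenvalues). -/
def TW (B : Finset G.V) (mu : ℂ) : Matrix B B ℂ :=
  Matrix.of fun k l : B => if h : ∃ f, G.IsTWsol mu l f then G.vtxVal h.choose k else 0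

/-- The cycle `c` has commensurate edges: all ratios of edge lengths are rational. -/
def Commensurate (c : G.Cycle) : Prop :=
  ∀ i j, ∃ q : ℚ, G.L (c.edge i) = q * G.L (c.edge j)

/-- `u_C`: the maximal number such that the length of each edge of the cycle `c` is a
positive integer multiple of it. -/
def uC (c : G.Cycle) : ℝ :=
  sSup {u : ℝ | 0 < u ∧ ∀ i, ∃ k : ℕ, 0 < k ∧ G.L (c.edge i) = k * u}

/-- `λ_G := inf { π²/u_C² : C a cycle in G with commensurate edges }`, with value `+∞`
if there is no cycle with commensurate edges. -/
def lamThreshold : EReal :=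
  sInf {x : EReal | ∃ c : G.Cycle, G.Commensurate c ∧ x = ((π ^ 2 / (G.uC c) ^ 2 : ℝ) : EReal)}

end MetricGraph

section MatrixFun

variable {m : Type} [Fintype m]

/-- The matrix function `M` has a pole of order `n` at `λ`:
`lim_{z → λ} (z - λ)^n M(z)` exists and is nonzero, while
`lim_{z → λ} (z - λ)^(n+1) M(z) = 0`. -/
def hasPoleOrder (M : ℂ → Matrix m m ℂ) (lam : ℂ) (n : ℕ) : Prop :=
  (∃ A : Matrix m m ℂ, A ≠ 0 ∧
    Filter.Tendsto (fun z => (z - lam) ^ n • M z) (𝓝[≠] lam) (𝓝 A)) ∧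
  Filter.Tendsto (fun z => (z - lam) ^ (n + 1) • M z) (𝓝[≠] lam) (𝓝 0)

/-- `λ` is a pole of the matrix function `M`: `M` is analytic on a punctured
neighborhood of `λ` and has a pole of some order `n ≥ 1` at `λ`. -/
def isPole (M : ℂ → Matrix m m ℂ) (lam : ℂ) : Prop :=
  (∀ᶠ z in 𝓝[≠] lam, ∀ k l, AnalyticAt ℂ (fun w => M w k l) z) ∧
  ∃ n : ℕ, 1 ≤ n ∧ hasPoleOrder M lam n

open scoped Classical in
/-- `Res_λ M := (2πi)⁻¹ ∮_Γ M(μ) dμ`, computed entrywise over a sufficiently small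
positively oriented circle `Γ` centered at `λ` (defined via choice as the common value
of the circle integrals over all sufficiently small radii). -/
def matResidue (M : ℂ → Matrix m m ℂ) (lam : ℂ) : Matrix m m ℂ :=
  Matrix.of fun k l =>
    if h : ∃ c : ℂ, ∀ᶠ R in 𝓝[>] (0 : ℝ),
        (2 * (π : ℂ) * Complex.I)⁻¹ * circleIntegral (fun z => M z k l) lam R = c
    then h.choose else 0

end MatrixFun


/-- The general solution `a cos (s x) + b sin (s x)` of `-f'' = s² f`. -/
def trig (s a b : ℂ) (x : ℝ) : ℂ := a * Complex.cos (s * x) + b * Complex.sin (s * x)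

lemma hasDerivAt_trig (s a b : ℂ) (x : ℝ) :
    HasDerivAt (trig s a b) (s * trig s b (-a) x) x := by
  have h1 : HasDerivAt (fun y : ℝ => s * (y : ℂ)) s x := by
    simpa using (Complex.ofRealCLM.hasDerivAt (x := x)).const_mul s
  have := (((Complex.hasDerivAt_cos _).comp x h1).const_mul a).add
    (((Complex.hasDerivAt_sin _).comp x h1).const_mul b)
  refine this.congr_deriv ?_
  simp only [trig]; ring

lemma deriv_trig (s a b : ℂ) : deriv (trig s a b) = fun x => s * trig s b (-a) x :=
  funext fun x => (hasDerivAt_trig s a b x).deriv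

lemma deriv_deriv_trig (s a b : ℂ) (x : ℝ) :
    deriv (deriv (trig s a b)) x = -s ^ 2 * trig s a b x := by
  rw [deriv_trig, ((hasDerivAt_trig s b (-a) x).const_mul s).deriv]
  simp only [trig]; ring

lemma contDiff_trig (s a b : ℂ) {n : WithTop ℕ∞} : ContDiff ℝ n (trig s a b) := by
  have h : ContDiff ℝ n (fun y : ℝ => s * (y : ℂ)) :=
    contDiff_const.mul Complex.ofRealCLM.contDiff
  have h2 : ContDiff ℝ n (fun z : ℂ => Complex.cos z) := Complex.contDiff_cos.restrict_scalars ℝ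
  have h3 : ContDiff ℝ n (fun z : ℂ => Complex.sin z) := Complex.contDiff_sin.restrict_scalars ℝ
  exact (contDiff_const.mul (h2.comp h)).add (contDiff_const.mul (h3.comp h))

section ODE

variable {f g : ℝ → ℂ} {mu nu : ℂ}

lemma ContDiff.hasDerivAt_of_two (hf : ContDiff ℝ 2 f) (x : ℝ) : HasDerivAt f (deriv f x) x :=
  (hf.differentiable (by norm_num) x).hasDerivAt

lemma ContDiff.contDiff_deriv_of_two (hf : ContDiff ℝ 2 f) : ContDiff ℝ 1 (deriv f) := by
  have : ContDiff ℝ (1 + 1) f := by simpa [one_add_one_eq_two] using hf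
  exact (contDiff_succ_iff_deriv.1 this).2.2

lemma ContDiff.hasDerivAt_deriv_of_two (hf : ContDiff ℝ 2 f) (x : ℝ) :
    HasDerivAt (deriv f) (deriv (deriv f) x) x :=
  (hf.contDiff_deriv_of_two.differentiable (by norm_num) x).hasDerivAt

/-- The derivative of the Wronskian of two solutions. -/
lemma hasDerivAt_wronskian (hf : ContDiff ℝ 2 f) (hf' : ∀ x, deriv (deriv f) x = -mu * f x)
    (hg : ContDiff ℝ 2 g) (hg' : ∀ x, deriv (deriv g) x = -nu * g x) (x : ℝ) :
    HasDerivAt (fun y => deriv f y * g y - f y * deriv g y) ((nu - mu) * (f x * g x)) x := by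
  have h := ((hf.hasDerivAt_deriv_of_two x).mul (hg.hasDerivAt_of_two x)).sub
    ((hf.hasDerivAt_of_two x).mul (hg.hasDerivAt_deriv_of_two x))
  refine h.congr_deriv ?_
  rw [hf', hg']; ring

lemma wronskian_const (hf : ContDiff ℝ 2 f) (hf' : ∀ x, deriv (deriv f) x = -mu * f x)
    (hg : ContDiff ℝ 2 g) (hg' : ∀ x, deriv (deriv g) x = -mu * g x) (x : ℝ) :
    deriv f x * g x - f x * deriv g x = deriv f 0 * g 0 - f 0 * deriv g 0 := by
  have h := hasDerivAt_wronskian hf hf' hg hg'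
  exact is_const_of_deriv_eq_zero (f := fun y => deriv f y * g y - f y * deriv g y)
    (fun y => (h y).differentiableAt)
    (fun y => by rw [(h y).deriv]; ring) x 0

/-- Every solution of `-f'' = s² f` is a combination of `cos (s x)` and `sin (s x)`. -/
lemma eq_trig_of_ode {s : ℂ} (hs : s ≠ 0) (hf : ContDiff ℝ 2 f)
    (hf' : ∀ x, deriv (deriv f) x = -s ^ 2 * f x) : f = trig s (f 0) (deriv f 0 / s) := by
  funext x
  have h1 := wronskian_const (mu := s ^ 2) hf hf' (contDiff_trig s 1 0) (deriv_deriv_trig s 1 0) x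
  have h2 := wronskian_const (mu := s ^ 2) hf hf' (contDiff_trig s 0 1) (deriv_deriv_trig s 0 1) x
  have h3 := Complex.sin_sq_add_cos_sq (s * x)
  simp only [deriv_trig, trig] at h1 h2 ⊢
  simp only [Complex.ofReal_zero, mul_zero, Complex.cos_zero, Complex.sin_zero] at h1 h2
  generalize Complex.cos (s * x) = c at *
  generalize Complex.sin (s * x) = d at *
  field_simp
  linear_combination d * h1 - c * h2 - s * f x * h3

/-- A solution with vanishing Cauchy data at some point vanishes. -/
lemma eq_zero_of_cauchy {s : ℂ} (hs : s ≠ 0) (hf : ContDiff ℝ 2 f)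
    (hf' : ∀ x, deriv (deriv f) x = -s ^ 2 * f x) {l : ℝ} (h0 : f l = 0) (h1 : deriv f l = 0) :
    f = 0 := by
  have hc := wronskian_const (mu := s ^ 2) hf hf' (contDiff_trig s 1 0) (deriv_deriv_trig s 1 0) l
  have hd := wronskian_const (mu := s ^ 2) hf hf' (contDiff_trig s 0 1) (deriv_deriv_trig s 0 1) l
  have ha : f 0 = 0 := by simpa [h0, h1, deriv_trig, trig, hs] using hd
  have hb : deriv f 0 = 0 := by simpa [h0, h1, deriv_trig, trig, hs] using hc.symm
  rw [eq_trig_of_ode hs hf hf', ha, hb]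
  funext x
  simp [trig]

/-- Green's identity on an interval. -/
lemma green_interval (hf : ContDiff ℝ 2 f) (hf' : ∀ x, deriv (deriv f) x = -mu * f x)
    (hg : ContDiff ℝ 2 g) (hg' : ∀ x, deriv (deriv g) x = -nu * g x) (l : ℝ) :
    (deriv f l * g l - f l * deriv g l) - (deriv f 0 * g 0 - f 0 * deriv g 0) =
      (nu - mu) * ∫ x in (0 : ℝ)..l, f x * g x := by
  rw [← intervalIntegral.integral_const_mul]
  symm
  apply intervalIntegral.integral_eq_sub_of_hasDerivAt
    (fun x _ => hasDerivAt_wronskian hf hf' hg hg' x)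
  exact (continuous_const.mul (hf.continuous.mul hg.continuous)).intervalIntegrable _ _

/-- A solution which is `L²`-orthogonal to its conjugate on `[0, l]` vanishes. -/
lemma eq_zero_of_integral_mul_conj {s : ℂ} (hs : s ≠ 0) (hf : ContDiff ℝ 2 f)
    (hf' : ∀ x, deriv (deriv f) x = -s ^ 2 * f x) {l : ℝ} (hl : 0 < l)
    (h : ∫ x in (0 : ℝ)..l, ‖f x‖ ^ 2 = 0) : f = 0 := by
  have hc : Continuous fun x => ‖f x‖ ^ 2 := hf.continuous.norm.pow 2
  have hz : ∀ x ∈ Icc 0 l, f x = 0 := by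
    intro x hx
    by_contra hne
    refine absurd h (ne_of_gt ?_)
    exact intervalIntegral.integral_pos hl hc.continuousOn (fun y _ => by positivity)
      ⟨x, hx, by positivity⟩
  have h0 : f 0 = 0 := hz 0 ⟨le_rfl, hl.le⟩
  have hd : deriv f 0 = 0 := by
    have h1 : HasDerivWithinAt f (deriv f 0) (Icc 0 l) 0 :=
      (hf.hasDerivAt_of_two 0).hasDerivWithinAt
    have h2 : HasDerivWithinAt f 0 (Icc 0 l) 0 :=
      (hasDerivWithinAt_const (0 : ℝ) (Icc 0 l) (0 : ℂ)).congr hz h0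
    exact (uniqueDiffOn_Icc hl 0 ⟨le_rfl, hl.le⟩).eq_deriv _ h1 h2
  rw [eq_trig_of_ode hs hf hf', h0, hd]
  funext x
  simp [trig]

end ODE

namespace MetricGraph

variable {G : MetricGraph}

section Vertex

variable {f g : G.E → ℝ → ℂ} {mu nu : ℂ}

lemma vtxVal_o (hf : G.ContVert f) (e : G.E) : G.vtxVal f (G.o e) = f e 0 := by
  have h : ∃ e', G.o e' = G.o e := ⟨e, rfl⟩
  rw [vtxVal, dif_pos h]
  exact hf.1 _ _ h.choose_spec

lemma vtxVal_t (hf : G.ContVert f) (e : G.E) : G.vtxVal f (G.t e) = f e (G.L e) := by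
  rw [vtxVal]
  split_ifs with h
  · exact hf.2.1 _ _ h.choose_spec
  · exact hf.2.2 _ _ ((G.noIsolated (G.t e)).choose_spec.resolve_left fun h' => h ⟨_, h'⟩)

lemma contVert_of_vertex {u : G.V → ℂ} (ho : ∀ e, f e 0 = u (G.o e))
    (ht : ∀ e, f e (G.L e) = u (G.t e)) : G.ContVert f :=
  ⟨fun _ _ h => by rw [ho, ho, h], fun _ _ h => by rw [ho, ht, h], fun _ _ h => by rw [ht, ht, h]⟩

lemma vtxVal_eq_of_vertex {u : G.V → ℂ} (ho : ∀ e, f e 0 = u (G.o e))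
    (ht : ∀ e, f e (G.L e) = u (G.t e)) : G.vtxVal f = u := by
  have hf := contVert_of_vertex ho ht
  funext v
  obtain ⟨e, rfl | rfl⟩ := G.noIsolated v
  · rw [vtxVal_o hf, ho]
  · rw [vtxVal_t hf, ht]

lemma IsSol.vtxVal_o (hf : G.IsSol mu f) (e : G.E) : G.vtxVal f (G.o e) = f e 0 :=
  MetricGraph.vtxVal_o hf.2.2 e

lemma IsSol.vtxVal_t (hf : G.IsSol mu f) (e : G.E) : G.vtxVal f (G.t e) = f e (G.L e) :=
  MetricGraph.vtxVal_t hf.2.2 e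

/-- Two edgewise solutions agree if they have the same Cauchy data at the initial vertices. -/
lemma IsSol.eq_trig {s : ℂ} (hs : s ≠ 0) (hf : G.IsSol (s ^ 2) f) (e : G.E) :
    f e = trig s (f e 0) (deriv (f e) 0 / s) :=
  eq_trig_of_ode hs (hf.1 e) (hf.2.1 e)

/-- The bilinear `L²` pairing of edgewise given functions. -/
def pair (f g : G.E → ℝ → ℂ) : ℂ := ∑ e, ∫ x in (0 : ℝ)..G.L e, f e x * g e x

lemma sum_normDer_mul (f : G.E → ℝ → ℂ) (u : G.V → ℂ) :
    ∑ v, G.normDer f v * u v =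
      ∑ e, (deriv (f e) (G.L e) * u (G.t e) - deriv (f e) 0 * u (G.o e)) := by
  simp only [normDer, sub_mul, Finset.sum_sub_distrib, Finset.sum_mul]
  congr 1
  · rw [← Finset.sum_fiberwise Finset.univ G.t]
    refine Finset.sum_congr rfl fun v _ => Finset.sum_congr rfl fun e he => ?_
    rw [(Finset.mem_filter.1 he).2]
  · rw [← Finset.sum_fiberwise Finset.univ G.o]
    refine Finset.sum_congr rfl fun v _ => Finset.sum_congr rfl fun e he => ?_
    rw [(Finset.mem_filter.1 he).2]

/-- Green's identity on a metric graph. -/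
lemma green (hf : G.IsSol mu f) (hg : G.IsSol nu g) :
    ∑ v, G.normDer f v * G.vtxVal g v - ∑ v, G.normDer g v * G.vtxVal f v =
      (nu - mu) * pair f g := by
  rw [sum_normDer_mul, sum_normDer_mul, pair, Finset.mul_sum, ← Finset.sum_sub_distrib]
  refine Finset.sum_congr rfl fun e _ => ?_
  rw [← green_interval (hf.1 e) (hf.2.1 e) (hg.1 e) (hg.2.1 e), hf.vtxVal_o, hf.vtxVal_t,
    hg.vtxVal_o, hg.vtxVal_t]
  ring

/-- The complex conjugate of an edgewise given function. -/
def conj (f : G.E → ℝ → ℂ) : G.E → ℝ → ℂ := fun e x => star (f e x)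

lemma deriv_conj_apply (f : G.E → ℝ → ℂ) (e : G.E) :
    deriv (conj f e) = fun x => star (deriv (f e) x) :=
  funext fun _ => deriv.star

lemma normDer_conj (f : G.E → ℝ → ℂ) (v : G.V) : G.normDer (conj f) v = star (G.normDer f v) := by
  simp [normDer, deriv_conj_apply]

lemma IsSol.conj (hf : G.IsSol mu f) : G.IsSol (star mu) (conj f) := by
  refine ⟨fun e => ?_, fun e x => ?_, fun e₁ e₂ h => ?_, fun e₁ e₂ h => ?_, fun e₁ e₂ h => ?_⟩
  · exact (starL' ℝ : ℂ ≃L[ℝ] ℂ).contDiff.comp (hf.1 e)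
  · rw [deriv_conj_apply]
    have : deriv (fun x => star (deriv (f e) x)) x = star (deriv (deriv (f e)) x) := deriv.star
    rw [this, hf.2.1]
    simp [MetricGraph.conj]
  · exact congrArg star (hf.2.2.1 _ _ h)
  · exact congrArg star (hf.2.2.2.1 _ _ h)
  · exact congrArg star (hf.2.2.2.2 _ _ h)

/-- The `L²` pairing with the conjugate is definite on solutions. -/
lemma IsSol.eq_zero_of_pair_conj {s : ℂ} (hs : s ≠ 0) (hf : G.IsSol (s ^ 2) f)
    (h : pair f (MetricGraph.conj f) = 0) : f = 0 := by
  have h1 : pair f (MetricGraph.conj f) =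
      ((∑ e, ∫ x in (0 : ℝ)..G.L e, ‖f e x‖ ^ 2 : ℝ) : ℂ) := by
    rw [pair, Complex.ofReal_sum]
    refine Finset.sum_congr rfl fun e _ => ?_
    rw [← intervalIntegral.integral_ofReal]
    refine intervalIntegral.integral_congr fun x _ => ?_
    simp [MetricGraph.conj, Complex.mul_conj, Complex.normSq_eq_norm_sq]
  rw [h1, Complex.ofReal_eq_zero, Finset.sum_eq_zero_iff_of_nonneg] at h
  · funext e
    exact eq_zero_of_integral_mul_conj hs (hf.1 e) (hf.2.1 e) (G.L_pos e) (h e (Finset.mem_univ e))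
  · intro e _
    exact intervalIntegral.integral_nonneg (G.L_pos e).le fun x _ => by positivity

/-- Eigenvalues of the Kirchhoff Laplacian are real. -/
lemma IsSol.eq_zero_of_im_ne_zero {s : ℂ} (hs : s ≠ 0) (him : (s ^ 2).im ≠ 0)
    (hf : G.IsSol (s ^ 2) f) (hn : ∀ v, G.normDer f v = 0) : f = 0 := by
  have h := green hf hf.conj
  simp only [normDer_conj, hn, star_zero, zero_mul, Finset.sum_const_zero, sub_zero] at h
  refine hf.eq_zero_of_pair_conj hs ((mul_eq_zero.1 h.symm).resolve_left fun h' => him ?_)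
  exact Complex.conj_eq_iff_im.1 (sub_eq_zero.1 h')

end Vertex

section System

variable (G)

/-- The indices of the finite linear system encoding the edgewise solutions: a cosine and a sine
coefficient for each edge and a value for each vertex. -/
abbrev Idx := G.E ⊕ G.E ⊕ G.V

variable {G}

/-- The edgewise solution with the given coefficients. -/
def solFun (s : ℂ) (x : G.Idx → ℂ) (e : G.E) : ℝ → ℂ :=
  trig s (x (.inl e)) (x (.inr (.inl e)))

variable (G) in
/-- The linear system for the coefficients of an edgewise solution: its components are the defects
of continuity at the initial and terminal vertices, and the normal derivatives. -/
def sysMap (s : ℂ) : (G.Idx → ℂ) →ₗ[ℂ] (G.Idx → ℂ) where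
  toFun x := Sum.elim (fun e => x (.inl e) - x (.inr (.inr (G.o e))))
    (Sum.elim (fun e => x (.inl e) * Complex.cos (s * G.L e) +
        x (.inr (.inl e)) * Complex.sin (s * G.L e) - x (.inr (.inr (G.t e))))
      (fun v => (∑ e ∈ Finset.univ.filter fun e => G.t e = v,
          s * (x (.inr (.inl e)) * Complex.cos (s * G.L e) +
            -x (.inl e) * Complex.sin (s * G.L e))) -
        ∑ e ∈ Finset.univ.filter fun e => G.o e = v, s * x (.inr (.inl e))))
  map_add' x y := by
    funext i
    rcases i with e | e | v
    · simp; ring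
    · simp; ring
    · simp only [Sum.elim_inr, Pi.add_apply]
      rw [sub_add_sub_comm, ← Finset.sum_add_distrib, ← Finset.sum_add_distrib]
      congr 1 <;> refine Finset.sum_congr rfl fun e _ => by ring
  map_smul' c x := by
    funext i
    rcases i with e | e | v
    · simp; ring
    · simp; ring
    · simp only [Sum.elim_inr, Pi.smul_apply, smul_eq_mul, RingHom.id_apply]
      rw [mul_sub, Finset.mul_sum, Finset.mul_sum]
      congr 1 <;> refine Finset.sum_congr rfl fun e _ => by ring

/-- The right-hand side of the linear system for given normal derivatives. -/
def rhs (u : G.V → ℂ) : G.Idx → ℂ := Sum.elim 0 (Sum.elim 0 u)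

lemma normDer_solFun (s : ℂ) (x : G.Idx → ℂ) (v : G.V) :
    G.normDer (solFun s x) v = G.sysMap s x (.inr (.inr v)) := by
  simp [normDer, solFun, deriv_trig, sysMap, trig]

lemma isSol_solFun {s : ℂ} {x : G.Idx → ℂ} {u : G.V → ℂ} (h : G.sysMap s x = rhs u) :
    G.IsSol (s ^ 2) (solFun s x) ∧ G.normDer (solFun s x) = u ∧
      ∀ v, G.vtxVal (solFun s x) v = x (.inr (.inr v)) := by
  have ho : ∀ e, solFun s x e 0 = x (.inr (.inr (G.o e))) := fun e => by
    have := congrFun h (.inl e)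
    simpa [sysMap, rhs, solFun, trig, sub_eq_zero] using this
  have ht : ∀ e, solFun s x e (G.L e) = x (.inr (.inr (G.t e))) := fun e => by
    have := congrFun h (.inr (.inl e))
    simpa [sysMap, rhs, solFun, trig, sub_eq_zero] using this
  refine ⟨⟨fun e => contDiff_trig _ _ _, fun e y => deriv_deriv_trig _ _ _ _,
    contVert_of_vertex (u := fun v => x (.inr (.inr v))) ho ht⟩, ?_,
    congrFun (vtxVal_eq_of_vertex (u := fun v => x (.inr (.inr v))) ho ht)⟩
  funext v
  rw [normDer_solFun, h]
  rfl

/-- The coefficients of an edgewise solution. -/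
def coef (s : ℂ) (f : G.E → ℝ → ℂ) : G.Idx → ℂ :=
  Sum.elim (fun e => f e 0) (Sum.elim (fun e => deriv (f e) 0 / s) (G.vtxVal f))

lemma solFun_coef {s : ℂ} (hs : s ≠ 0) {f : G.E → ℝ → ℂ} (hf : G.IsSol (s ^ 2) f) :
    solFun s (coef s f) = f :=
  funext fun e => (hf.eq_trig hs e).symm

lemma sysMap_coef {s : ℂ} (hs : s ≠ 0) {f : G.E → ℝ → ℂ} (hf : G.IsSol (s ^ 2) f) :
    G.sysMap s (coef s f) = rhs (G.normDer f) := by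
  funext i
  rcases i with e | e | v
  · simp [sysMap, coef, rhs, hf.vtxVal_o]
  · have := congrFun (hf.eq_trig hs e) (G.L e)
    simp [sysMap, coef, rhs, hf.vtxVal_t, this.trans (by rfl : _ = _ + _)]
  · rw [← normDer_solFun, solFun_coef hs hf]
    rfl

lemma eq_zero_of_solFun_eq_zero {s : ℂ} (hs : s ≠ 0) {x : G.Idx → ℂ} {u : G.V → ℂ}
    (h : G.sysMap s x = rhs u) (h0 : solFun s x = 0) : x = 0 := by
  funext i
  rcases i with e | e | v
  · have := congrFun (congrFun h0 e) 0
    simpa [solFun, trig] using this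
  · have := congrFun (congrArg deriv (congrFun h0 e)) 0
    simpa [solFun, deriv_trig, trig, hs] using this
  · rw [← (isSol_solFun h).2.2, h0]
    simp [vtxVal]

end System

end MetricGraph

namespace MetricGraph

variable {G : MetricGraph}

/-- The principal square root. -/
def rt (z : ℂ) : ℂ := Complex.exp (Complex.log z / 2)

lemma rt_sq {z : ℂ} (hz : z ≠ 0) : rt z ^ 2 = z := by
  rw [rt, ← Complex.exp_nat_mul]
  push_cast
  rw [mul_div_cancel₀ _ two_ne_zero, Complex.exp_log hz]

lemma rt_ne_zero (z : ℂ) : rt z ≠ 0 := Complex.exp_ne_zero _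

lemma analyticAt_rt {z : ℂ} (hz : z ∈ Complex.slitPlane) : AnalyticAt ℂ rt z := by
  have h : AnalyticAt ℂ (fun w => Complex.log w / 2) z := (analyticAt_clog hz).div_const
  exact h.cexp

lemma analyticAt_sysMap {s : ℂ → ℂ} {y : ℂ → G.Idx → ℂ} {z : ℂ} (hs : AnalyticAt ℂ s z)
    (hy : AnalyticAt ℂ y z) (i : G.Idx) : AnalyticAt ℂ (fun w => G.sysMap (s w) (y w) i) z := by
  have hy' : ∀ j, AnalyticAt ℂ (fun w => y w j) z := analyticAt_pi_iff.1 hy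
  have hsl : ∀ e : G.E, AnalyticAt ℂ (fun w => s w * G.L e) z := fun e => hs.mul analyticAt_const
  have hcos : ∀ e : G.E, AnalyticAt ℂ (fun w => Complex.cos (s w * G.L e)) z := fun e =>
    (Complex.differentiable_cos.analyticAt _).comp (hsl e)
  have hsin : ∀ e : G.E, AnalyticAt ℂ (fun w => Complex.sin (s w * G.L e)) z := fun e =>
    (Complex.differentiable_sin.analyticAt _).comp (hsl e)
  rcases i with e | e | v
  · exact (hy' _).sub (hy' _)
  · exact (((hy' _).mul (hcos e)).add ((hy' _).mul (hsin e))).sub (hy' _)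
  · refine AnalyticAt.sub ?_ ?_
    · exact Finset.analyticAt_fun_sum _ fun e _ =>
        hs.mul (((hy' _).mul (hcos e)).add ((hy' _).neg.mul (hsin e)))
    · exact Finset.analyticAt_fun_sum _ fun e _ => hs.mul (hy' _)

variable (G) in
/-- The matrix of the linear system. -/
def sysMat (s : ℂ) : Matrix G.Idx G.Idx ℂ := LinearMap.toMatrix' (G.sysMap s)

lemma sysMat_mulVec (s : ℂ) (x : G.Idx → ℂ) : Matrix.mulVec (G.sysMat s) x = G.sysMap s x :=
  LinearMap.toMatrix'_mulVec _ _

lemma analyticAt_sysMat {s : ℂ → ℂ} {z : ℂ} (hs : AnalyticAt ℂ s z) (i j : G.Idx) :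
    AnalyticAt ℂ (fun w => G.sysMat (s w) i j) z := by
  simp only [sysMat, LinearMap.toMatrix'_apply]
  exact analyticAt_sysMap hs analyticAt_const i

lemma analyticAt_det {n : Type*} [Fintype n] [DecidableEq n] {M : ℂ → Matrix n n ℂ} {z : ℂ}
    (hM : ∀ i j, AnalyticAt ℂ (fun w => M w i j) z) : AnalyticAt ℂ (fun w => (M w).det) z := by
  simp only [Matrix.det_apply]
  refine Finset.analyticAt_fun_sum _ fun σ _ => ?_
  simp only [Units.smul_def, zsmul_eq_mul]
  exact analyticAt_const.mul (Finset.analyticAt_fun_prod _ fun i _ => hM _ _)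

lemma analyticAt_adjugate {n : Type*} [Fintype n] [DecidableEq n] {M : ℂ → Matrix n n ℂ} {z : ℂ}
    (hM : ∀ i j, AnalyticAt ℂ (fun w => M w i j) z) (i j : n) :
    AnalyticAt ℂ (fun w => (M w).adjugate i j) z := by
  simp only [Matrix.adjugate_apply]
  refine analyticAt_det fun k l => ?_
  by_cases hk : k = j
  · subst hk; simpa using analyticAt_const
  · simpa [Matrix.updateRow_ne hk] using hM k l

lemma rhs_add_smul_single (c : ℂ) (v : G.V) :
    (rhs (Pi.single v c) : G.Idx → ℂ) = c • rhs (Pi.single v 1) := by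
  funext i
  rcases i with e | e | w
  · simp [rhs]
  · simp [rhs]
  · simp [rhs, Pi.single_apply]

lemma det_sysMat_ne_zero_of_im {s : ℂ} (hs : s ≠ 0) (him : (s ^ 2).im ≠ 0) :
    (G.sysMat s).det ≠ 0 := by
  intro h
  obtain ⟨x, hx, h0⟩ := Matrix.exists_mulVec_eq_zero_iff.2 h
  rw [sysMat_mulVec] at h0
  have h1 : G.sysMap s x = rhs 0 := by
    rw [h0]
    funext i
    rcases i with e | e | v <;> rfl
  obtain ⟨hsol, hn, -⟩ := isSol_solFun h1
  exact hx (eq_zero_of_solFun_eq_zero hs h1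
    (hsol.eq_zero_of_im_ne_zero hs him fun v => congrFun hn v))

section Pole

variable {lam : ℝ}

lemma ofReal_mem_slitPlane_of_pos (hlam : 0 < lam) : (lam : ℂ) ∈ Complex.slitPlane :=
  Complex.ofReal_mem_slitPlane.2 hlam

lemma eventually_ne_zero (hlam : 0 < lam) : ∀ᶠ z in 𝓝 (lam : ℂ), z ≠ 0 :=
  isOpen_ne.mem_nhds (Complex.ofReal_ne_zero.2 hlam.ne')

lemma analyticAt_det_sysMat (hlam : 0 < lam) :
    AnalyticAt ℂ (fun z => (G.sysMat (rt z)).det) lam :=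
  analyticAt_det fun i j => analyticAt_sysMat (analyticAt_rt (ofReal_mem_slitPlane_of_pos hlam)) i j

variable (G) in
lemma eventually_det_ne_zero (hlam : 0 < lam) :
    ∀ᶠ z in 𝓝[≠] (lam : ℂ), (G.sysMat (rt z)).det ≠ 0 := by
  refine (analyticAt_det_sysMat hlam).eventually_eq_zero_or_eventually_ne_zero.resolve_left
    fun h => ?_
  have ht : Tendsto (fun t : ℝ => (lam : ℂ) + t * Complex.I) (𝓝[>] 0) (𝓝 lam) := by
    have : Continuous fun t : ℝ => (lam : ℂ) + t * Complex.I := by fun_prop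
    simpa using (this.tendsto 0).mono_left nhdsWithin_le_nhds
  obtain ⟨t, ⟨ht0, ht1⟩, ht2⟩ := ((ht.eventually (h.and (eventually_ne_zero hlam))).and
    self_mem_nhdsWithin).exists
  refine det_sysMat_ne_zero_of_im (rt_ne_zero _) ?_ ht0
  rw [rt_sq ht1]
  simpa using (ne_of_gt ht2)

lemma pair_continuousAt {s : ℂ → ℂ} {y : ℂ → G.Idx → ℂ} {z : ℂ} (hs : ContinuousAt s z)
    (hy : ContinuousAt y z) {g : G.E → ℝ → ℂ} (hg : ∀ e, Continuous (g e)) :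
    ContinuousAt (fun w => pair (solFun (s w) (y w)) g) z := by
  have hy' : ∀ j, ContinuousAt (fun w => y w j) z := continuousAt_pi.1 hy
  refine tendsto_finsetSum _ fun e _ => ?_
  have hc : Continuous fun p : ℂ × ℂ × ℂ =>
      ∫ x in (0 : ℝ)..G.L e, trig p.1 p.2.1 p.2.2 x * g e x := by
    refine intervalIntegral.continuous_parametric_intervalIntegral_of_continuous' ?_ _ _
    have := hg e
    simp only [Function.uncurry_def, trig]
    fun_prop
  exact hc.continuousAt.comp (f := fun w => (s w, y w (.inl e), y w (.inr (.inl e))))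
    (hs.prodMk ((hy' _).prodMk (hy' _)))

/-- Green's identity for an analytic family of solutions paired with an eigenfunction. -/
lemma pair_of_family (hlam : 0 < lam) {n : ℕ} {v : G.V} {y : ℂ → G.Idx → ℂ}
    (hy : AnalyticAt ℂ y lam)
    (h : ∀ᶠ z in 𝓝 (lam : ℂ), G.sysMap (rt z) (y z) = (z - lam) ^ (n + 1) • rhs (Pi.single v 1))
    {g : G.E → ℝ → ℂ} (hg : G.InKer lam g) :
    pair (solFun (rt lam) (y lam)) g = -(0 ^ n * G.vtxVal g v) := by
  have h1 : ContinuousAt (fun w => pair (solFun (rt w) (y w)) g) lam :=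
    pair_continuousAt (analyticAt_rt (ofReal_mem_slitPlane_of_pos hlam)).continuousAt
      hy.continuousAt fun e => (hg.1.1 e).continuous
  have h2 : ContinuousAt (fun w : ℂ => -((w - lam) ^ n * G.vtxVal g v)) lam := by fun_prop
  have h3 : (fun w => pair (solFun (rt w) (y w)) g) =ᶠ[𝓝[≠] (lam : ℂ)]
      fun w : ℂ => -((w - lam) ^ n * G.vtxVal g v) := by
    filter_upwards [nhdsWithin_le_nhds h, nhdsWithin_le_nhds (eventually_ne_zero hlam),
      self_mem_nhdsWithin] with z hz hz0 hzl
    rw [← rhs_add_smul_single] at hz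
    obtain ⟨hsol, hn, -⟩ := isSol_solFun hz
    rw [rt_sq hz0] at hsol
    have hgr := green hsol hg.1
    simp only [hn, hg.2, zero_mul, Finset.sum_const_zero, sub_zero, Pi.single_apply, ite_mul,
      Finset.sum_ite_eq', Finset.mem_univ, if_true] at hgr
    have hne : z - lam ≠ 0 := sub_ne_zero.2 hzl
    apply mul_left_cancel₀ hne
    linear_combination hgr
  have h4 := tendsto_nhds_unique (h1.tendsto.mono_left nhdsWithin_le_nhds)
    ((h2.tendsto.mono_left nhdsWithin_le_nhds).congr' h3.symm)
  simpa using h4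

lemma InKer.conj {f : G.E → ℝ → ℂ} (hf : G.InKer lam f) : G.InKer lam (conj f) := by
  refine ⟨?_, fun v => by rw [normDer_conj, hf.2, star_zero]⟩
  have := hf.1.conj
  rwa [show star (lam : ℂ) = lam from Complex.conj_ofReal lam] at this

lemma inKer_of_family (hlam : 0 < lam) {n : ℕ} {v : G.V} {y : ℂ → G.Idx → ℂ}
    (h : ∀ᶠ z in 𝓝 (lam : ℂ), G.sysMap (rt z) (y z) = (z - lam) ^ (n + 1) • rhs (Pi.single v 1)) :
    G.sysMap (rt lam) (y lam) = rhs 0 ∧ G.InKer lam (solFun (rt lam) (y lam)) := by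
  have h0 : G.sysMap (rt lam) (y lam) = rhs 0 := by
    rw [h.self_of_nhds, ← rhs_add_smul_single]
    simp
  obtain ⟨hsol, hn, -⟩ := isSol_solFun h0
  rw [rt_sq (by exact_mod_cast hlam.ne')] at hsol
  exact ⟨h0, hsol, congrFun hn⟩

/-- The order of the pole of the resolvent family can be lowered to one. -/
lemma family_descent (hlam : 0 < lam) {n : ℕ} {v : G.V} {y : ℂ → G.Idx → ℂ}
    (hy : AnalyticAt ℂ y lam)
    (h : ∀ᶠ z in 𝓝 (lam : ℂ), G.sysMap (rt z) (y z) = (z - lam) ^ (n + 1) • rhs (Pi.single v 1)) :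
    ∃ y' : ℂ → G.Idx → ℂ, AnalyticAt ℂ y' lam ∧
      ∀ᶠ z in 𝓝 (lam : ℂ), G.sysMap (rt z) (y' z) = (z - lam) • rhs (Pi.single v 1) := by
  induction n generalizing y with
  | zero => exact ⟨y, hy, by simpa using h⟩
  | succ n ih =>
    obtain ⟨h0, hker⟩ := inKer_of_family hlam h
    have hpair := pair_of_family hlam hy h hker.conj
    rw [zero_pow n.succ_ne_zero, zero_mul, neg_zero] at hpair
    have hsol := (isSol_solFun h0).1
    have hy0 : y lam = 0 := eq_zero_of_solFun_eq_zero (rt_ne_zero _) h0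
      (hsol.eq_zero_of_pair_conj (rt_ne_zero _) hpair)
    obtain ⟨p, hp⟩ := hy
    have hd : AnalyticAt ℂ (dslope y lam) lam := ⟨_, hp.has_fpower_series_dslope_fslope⟩
    refine ih hd ?_
    have hsmul : ∀ z, y z = (z - lam) • dslope y lam z := fun z => by
      rw [sub_smul_dslope, hy0, sub_zero]
    have hne : ∀ᶠ z in 𝓝[≠] (lam : ℂ), G.sysMap (rt z) (dslope y lam z) =
        (z - lam) ^ (n + 1) • rhs (Pi.single v 1) := by
      filter_upwards [nhdsWithin_le_nhds h, self_mem_nhdsWithin] with z hz hzl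
      have hne : z - lam ≠ 0 := sub_ne_zero.2 hzl
      rw [hsmul, map_smul, pow_succ', mul_smul] at hz
      exact smul_right_injective _ hne hz
    have hc1 : ContinuousAt (fun z => G.sysMap (rt z) (dslope y lam z)) lam :=
      continuousAt_pi.2 fun i => (analyticAt_sysMap
        (analyticAt_rt (ofReal_mem_slitPlane_of_pos hlam)) hd i).continuousAt
    have hc2 : ContinuousAt (fun z : ℂ => (z - lam) ^ (n + 1) •
        (rhs (Pi.single v 1) : G.Idx → ℂ)) lam := by fun_prop
    have heq := tendsto_nhds_unique (hc1.tendsto.mono_left nhdsWithin_le_nhds)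
      ((hc2.tendsto.mono_left nhdsWithin_le_nhds).congr' (hne.mono fun _ h => h.symm))
    rw [← nhdsNE_sup_pure, eventually_sup]
    exact ⟨hne, heq⟩

variable (G) in
/-- The family of Titchmarsh--Weyl solutions has at most a simple pole at `λ`. -/
lemma exists_family (hlam : 0 < lam) (v : G.V) :
    ∃ y : ℂ → G.Idx → ℂ, AnalyticAt ℂ y lam ∧
      ∀ᶠ z in 𝓝 (lam : ℂ), G.sysMap (rt z) (y z) = (z - lam) • rhs (Pi.single v 1) := by
  have hd := analyticAt_det_sysMat (G := G) hlam
  obtain ⟨n, g, hg, hg0, hdg⟩ := hd.exists_eventuallyEq_pow_smul_nonzero_iff.2 fun h0 => by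
    obtain ⟨z, hz, hz'⟩ := ((eventually_det_ne_zero G hlam).and (nhdsWithin_le_nhds h0)).exists
    exact hz hz'
  have hrt := analyticAt_rt (ofReal_mem_slitPlane_of_pos hlam)
  let r : G.Idx → ℂ := rhs (Pi.single v 1)
  have hadj : AnalyticAt ℂ (fun z => Matrix.mulVec (G.sysMat (rt z)).adjugate r) lam :=
    analyticAt_pi_iff.2 fun i => Finset.analyticAt_fun_sum _ fun j _ =>
      (analyticAt_adjugate (fun k l => analyticAt_sysMat hrt k l) i j).mul analyticAt_const
  have hy : AnalyticAt ℂ (fun z : ℂ => (z - lam) •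
      (g z)⁻¹ • Matrix.mulVec (G.sysMat (rt z)).adjugate r) lam :=
    (analyticAt_id.sub analyticAt_const).smul ((hg.inv hg0).smul hadj)
  refine family_descent (n := n) hlam hy ?_
  filter_upwards [hdg, hg.continuousAt.eventually_ne hg0] with z hz hgz
  rw [map_smul, map_smul, ← sysMat_mulVec, Matrix.mulVec_mulVec, Matrix.mul_adjugate, hz,
    Matrix.smul_mulVec, Matrix.one_mulVec, pow_succ', mul_smul, smul_smul (g z)⁻¹,
    smul_eq_mul, mul_left_comm, inv_mul_cancel₀ hgz, mul_one]

end Pole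

end MetricGraph

namespace MetricGraph

variable {G : MetricGraph}

section Combinatorics

/-- The sign relation along the edges of `S` transfers to a sign along every edge direction. -/
lemma sign_esrc {S : Set G.E} {k : G.E → ℕ} {g : G.V → ℂ}
    (hg : ∀ e ∈ S, g (G.o e) = (-1) ^ k e * g (G.t e)) {e : G.E} (he : e ∈ S) (d : Bool) :
    g (G.esrc e d) = (-1) ^ k e * g (G.edst e d) := by
  cases d
  · simp only [esrc, edst, Bool.false_eq_true, if_false]
    rw [hg e he, ← mul_assoc, ← pow_add, ← two_mul, pow_mul]
    simp
  · simpa [esrc, edst] using hg e he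

/-- Odd cycles force the vanishing of functions obeying the sign relation. -/
lemma eq_zero_at_start {S : Set G.E} {k : G.E → ℕ} {g : G.V → ℂ} {x : ℝ} (hx : 0 < x)
    (hk : ∀ e ∈ S, G.L e = k e * x) (hg : ∀ e ∈ S, g (G.o e) = (-1) ^ k e * g (G.t e))
    (c : G.Cycle) (hc : c.inSub S) (hodd : c.oddLength x) : g c.start = 0 := by
  have hpos := c.npos
  let idx : ℕ → Fin c.n := fun j => ⟨j % c.n, Nat.mod_lt _ hpos⟩
  let src : ℕ → G.V := fun j => G.esrc (c.edge (idx j)) (c.dir (idx j))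
  have hstep : ∀ j, g (src j) = (-1) ^ k (c.edge (idx j)) * g (src (j + 1)) := fun j => by
    have h1 : G.edst (c.edge (idx j)) (c.dir (idx j)) = src (j + 1) := by
      rw [c.chain]
      simp only [src, idx, Nat.mod_add_mod]
    rw [← h1]
    exact sign_esrc hg (hc _) _
  have hwalk : ∀ j, g (src 0) =
      (-1) ^ (∑ i ∈ Finset.range j, k (c.edge (idx i))) * g (src j) := fun j => by
    induction j with
    | zero => simp
    | succ j ih => rw [ih, hstep, Finset.sum_range_succ, pow_add, mul_assoc]
  have hsum : ∑ i ∈ Finset.range c.n, k (c.edge (idx i)) = ∑ i, k (c.edge i) := by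
    rw [Finset.sum_range]
    refine Finset.sum_congr rfl fun i _ => ?_
    have : idx i = i := Fin.ext (Nat.mod_eq_of_lt i.2)
    rw [this]
  obtain ⟨m, hm, hlen⟩ := hodd
  have hkm : ∑ i, k (c.edge i) = m := by
    have h1 : c.length = ((∑ i, k (c.edge i) : ℕ) : ℝ) * x := by
      rw [Cycle.length, Nat.cast_sum, Finset.sum_mul]
      exact Finset.sum_congr rfl fun i _ => hk _ (hc i)
    rw [h1] at hlen
    exact_mod_cast mul_right_cancel₀ hx.ne' hlen
  have hfin := hwalk c.n
  have hn0 : src c.n = src 0 := by simp only [src, idx, Nat.mod_self, Nat.zero_mod]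
  have hs0 : src 0 = c.start := by
    simp only [src, idx, Nat.zero_mod]
    rfl
  rw [hsum, hkm, hm.neg_one_pow, hn0, hs0] at hfin
  linear_combination hfin / 2

lemma eq_zero_iff_of_connRel {S : Set G.E} {k : G.E → ℕ} {g : G.V → ℂ}
    (hg : ∀ e ∈ S, g (G.o e) = (-1) ^ k e * g (G.t e)) {v w : G.V} (h : G.connRel S v w) :
    g v = 0 ↔ g w = 0 := by
  induction h with
  | rel v w h =>
    obtain ⟨e, he, rfl, rfl⟩ := h
    rw [hg e he]
    simp
  | refl => rfl
  | symm _ _ _ ih => exact ih.symm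
  | trans _ _ _ _ _ ih₁ ih₂ => exact ih₁.trans ih₂

lemma connRel_of_component_eq {S : Set G.E} {v w : G.V} (h : G.component S v = G.component S w) :
    G.connRel S v w := by
  have : w ∈ G.component S w := Relation.EqvGen.refl w
  rwa [← h] at this

open scoped Classical in
/-- The signed incidence matrix of the subgraph given by the edge set `S`. -/
def signedInc (S : Set G.E) (k : G.E → ℕ) : Matrix (G.incVerts S) S ℂ :=
  Matrix.of fun v e => (if G.t e = v then (-1) ^ k e else 0) - if G.o e = v then 1 else 0

open scoped Classical in
/-- The left kernel of the signed incidence matrix is at most as large as the number of components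
without an odd cycle. -/
lemma finrank_ker_transpose_le {S : Set G.E} {k : G.E → ℕ} {x : ℝ} (hx : 0 < x)
    (hk : ∀ e ∈ S, G.L e = k e * x) :
    Module.finrank ℂ (LinearMap.ker (signedInc S k).transpose.mulVecLin) + G.beta0odd S x ≤
      G.beta0 S := by
  set N := LinearMap.ker (signedInc S k).transpose.mulVecLin with hN
  set odds : Set G.V := {v | v ∈ G.incVerts S ∧
    ∃ c : G.Cycle, c.inSub S ∧ c.oddLength x ∧ G.connRel S v c.start} with hodds
  have hsub : G.component S '' odds ⊆ G.component S '' G.incVerts S :=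
    Set.image_mono fun v hv => hv.1
  let Q : Set (Set G.V) := (G.component S '' G.incVerts S) \ (G.component S '' odds)
  have hcard : Q.ncard + G.beta0odd S x = G.beta0 S :=
    Set.ncard_sdiff_add_ncard_of_subset hsub
  have hrep : ∀ C : Q, ∃ v : G.incVerts S, G.component S v = C := fun C => by
    obtain ⟨v, hv, h⟩ := C.2.1
    exact ⟨⟨v, hv⟩, h⟩
  choose rep hrep using hrep
  let ψ : N →ₗ[ℂ] (Q → ℂ) := (LinearMap.funLeft ℂ ℂ rep).comp N.subtype
  have hψ : Function.Injective ψ := by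
    rw [injective_iff_map_eq_zero]
    rintro ⟨g, hgN⟩ hg0
    let u : G.V → ℂ := fun v => if h : v ∈ G.incVerts S then g ⟨v, h⟩ else 0
    have hu : ∀ v : G.incVerts S, u v = g v := fun v => dif_pos v.2
    have hrel : ∀ e ∈ S, u (G.o e) = (-1) ^ k e * u (G.t e) := fun e he => by
      have ho : G.o e ∈ G.incVerts S := ⟨e, he, Or.inl rfl⟩
      have ht : G.t e ∈ G.incVerts S := ⟨e, he, Or.inr rfl⟩
      have h1 := congrFun (LinearMap.mem_ker.1 hgN) ⟨e, he⟩
      have h2 : ∀ v : G.incVerts S, (G.t e = v) ↔ (v = ⟨G.t e, ht⟩) := fun v =>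
        ⟨fun h => Subtype.ext h.symm, fun h => h ▸ rfl⟩
      have h3 : ∀ v : G.incVerts S, (G.o e = v) ↔ (v = ⟨G.o e, ho⟩) := fun v =>
        ⟨fun h => Subtype.ext h.symm, fun h => h ▸ rfl⟩
      simp only [Matrix.mulVecLin_apply, Matrix.mulVec, dotProduct, Matrix.transpose_apply,
        signedInc, Matrix.of_apply, sub_mul, Finset.sum_sub_distrib, h2, h3, ite_mul, zero_mul,
        one_mul, Finset.sum_ite_eq', Finset.mem_univ, if_true,
        Pi.zero_apply] at h1
      rw [hu ⟨_, ho⟩, hu ⟨_, ht⟩]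
      exact (sub_eq_zero.1 h1).symm
    apply Subtype.ext
    funext v
    change g v = 0
    rw [← hu v]
    by_cases hv : G.component S v ∈ G.component S '' odds
    · obtain ⟨w, ⟨-, c, hc, hcodd, hwc⟩, hw⟩ := hv
      rw [← eq_zero_iff_of_connRel hrel (connRel_of_component_eq hw),
        eq_zero_iff_of_connRel hrel hwc]
      exact eq_zero_at_start hx hk hrel c hc hcodd
    · let C : Q := ⟨G.component S v, ⟨v, v.2, rfl⟩, hv⟩
      rw [← eq_zero_iff_of_connRel hrel (connRel_of_component_eq (hrep C)), hu]
      exact congrFun hg0 C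
  have h1 := LinearMap.finrank_le_finrank_of_injective hψ
  rw [Module.finrank_pi, ← Nat.card_eq_fintype_card, Nat.card_coe_set_eq] at h1
  omega

open scoped Classical in
/-- If the first Betti number is the number of components with an odd cycle, then the signed
incidence matrix is injective. -/
lemma eq_zero_of_betti {S : Set G.E} {k : G.E → ℕ} {x : ℝ} (hx : 0 < x)
    (hk : ∀ e ∈ S, G.L e = k e * x) (hbetti : G.beta1 S = (G.beta0odd S x : ℤ)) {b : G.E → ℂ}
    (hb : ∀ e, e ∉ S → b e = 0)
    (hK : ∀ v, ∑ e ∈ Finset.univ.filter (fun e => G.t e = v), (-1) ^ k e * b e =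
      ∑ e ∈ Finset.univ.filter (fun e => G.o e = v), b e) : b = 0 := by
  have h1 := finrank_ker_transpose_le hx hk
  have h2 := (signedInc S k).mulVecLin.finrank_range_add_finrank_ker
  have h3 := (signedInc S k).transpose.mulVecLin.finrank_range_add_finrank_ker
  have h4 := Matrix.rank_transpose (signedInc S k)
  rw [Module.finrank_pi, ← Nat.card_eq_fintype_card, Nat.card_coe_set_eq] at h2 h3
  simp only [Matrix.rank] at h4
  simp only [beta1] at hbetti
  have hker : Module.finrank ℂ (LinearMap.ker (signedInc S k).mulVecLin) = 0 := by omega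
  rw [Submodule.finrank_eq_zero] at hker
  have hmem : (fun e : S => b e) ∈ LinearMap.ker (signedInc S k).mulVecLin := by
    rw [LinearMap.mem_ker]
    funext v
    have hext : ∀ F : G.E → ℂ, (∀ e, e ∉ S → F e = 0) → ∑ e : S, F e = ∑ e, F e := fun F hF =>
      (Finset.sum_subtype (Finset.univ.filter (· ∈ S)) (by simp) F).symm.trans
        (Finset.sum_filter_of_ne fun e _ h => by_contra fun h' => h (hF e h'))
    have := hK v
    rw [Finset.sum_filter, Finset.sum_filter, ← hext _ (by simp +contextual [hb]),
      ← hext _ (by simp +contextual [hb])] at this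
    simp only [Matrix.mulVecLin_apply, Matrix.mulVec, dotProduct, signedInc, Matrix.of_apply,
      sub_mul, Finset.sum_sub_distrib, ite_mul, zero_mul, one_mul, Pi.zero_apply]
    exact sub_eq_zero.2 this
  rw [hker, Submodule.mem_bot] at hmem
  funext e
  by_cases he : e ∈ S
  · exact congrFun hmem ⟨e, he⟩
  · exact hb e he

end Combinatorics

section Vanishing

variable {lam : ℝ} {f : G.E → ℝ → ℂ}

lemma InKer.isSol_sqrt (hlam : 0 < lam) (hf : G.InKer lam f) :
    G.IsSol ((Real.sqrt lam : ℂ) ^ 2) f := by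
  rw [← Complex.ofReal_pow, Real.sq_sqrt hlam.le]
  exact hf.1

lemma ofReal_sqrt_ne_zero (hlam : 0 < lam) : (Real.sqrt lam : ℂ) ≠ 0 :=
  Complex.ofReal_ne_zero.2 (Real.sqrt_pos.2 hlam).ne'

/-- An eigenfunction vanishing at the boundary and proper core vertices vanishes at all vertices. -/
lemma InKer.vtxVal_eq_zero {B : Finset G.V} (hbd : ∀ v, G.IsBoundaryVertex v → v ∈ B)
    (hcore : ∀ v, G.IsProperCoreVertex v → v ∈ B) (hlam : 0 < lam) (hf : G.InKer lam f)
    (hB : ∀ v ∈ B, G.vtxVal f v = 0) (v : G.V) : G.vtxVal f v = 0 := by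
  have hsol := hf.isSol_sqrt hlam
  have hs := ofReal_sqrt_ne_zero hlam
  have hinc : ∀ v e, (G.o e = v ∨ G.t e = v) → f e = 0 → G.vtxVal f v = 0 := by
    rintro v e (rfl | rfl) h
    · rw [hsol.vtxVal_o, h]; rfl
    · rw [hsol.vtxVal_t, h]; rfl
  have hsupp : {e | f e ≠ 0} ⊆ G.coreEdges := by
    refine Set.subset_sUnion_of_mem fun w hw => ?_
    have hw0 : G.vtxVal f w = 0 := by
      by_contra hne
      refine hne (hB w (hbd w ?_))
      rw [IsBoundaryVertex, degree, ← hw, degreeIn]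
      congr 2 <;> ext e <;> simp only [Set.mem_ofPred_eq, iff_and_self] <;> intro h h0
      · exact hne (hinc w e (Or.inl h) h0)
      · exact hne (hinc w e (Or.inr h) h0)
    have hn := hf.2 w
    rw [normDer] at hn
    rw [degreeIn, Nat.add_eq_one_iff] at hw
    have hdz : ∀ e x, f e = 0 → deriv (f e) x = 0 := fun e x h => by
      rw [h]; simp
    rcases hw with ⟨h0, h1⟩ | ⟨h1, h0⟩
    · obtain ⟨e, he⟩ := Set.ncard_eq_one.1 h1
      rw [Set.ncard_eq_zero] at h0
      have hmem : f e ≠ 0 ∧ G.t e = w := he.ge rfl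
      have huniq : ∀ e', G.t e' = w → e' ≠ e → f e' = 0 := fun e' h' hne => by
        by_contra hfe
        exact hne (he.le ⟨hfe, h'⟩)
      have hnone : ∀ e', G.o e' = w → f e' = 0 := fun e' h' => by
        by_contra hfe
        exact h0.le ⟨hfe, h'⟩
      rw [Finset.sum_eq_single e, Finset.sum_eq_zero, sub_zero] at hn
      · refine hmem.1 (eq_zero_of_cauchy hs (hsol.1 e) (hsol.2.1 e) (l := G.L e) ?_ hn)
        rw [← hsol.vtxVal_t, hmem.2, hw0]
      · exact fun e' h' => hdz _ _ (hnone e' (Finset.mem_filter.1 h').2)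
      · exact fun e' h' hne => hdz _ _ (huniq e' (Finset.mem_filter.1 h').2 hne)
      · exact fun h' => absurd (Finset.mem_filter.2 ⟨Finset.mem_univ e, hmem.2⟩) h'
    · obtain ⟨e, he⟩ := Set.ncard_eq_one.1 h1
      rw [Set.ncard_eq_zero] at h0
      have hmem : f e ≠ 0 ∧ G.o e = w := he.ge rfl
      have huniq : ∀ e', G.o e' = w → e' ≠ e → f e' = 0 := fun e' h' hne => by
        by_contra hfe
        exact hne (he.le ⟨hfe, h'⟩)
      have hnone : ∀ e', G.t e' = w → f e' = 0 := fun e' h' => by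
        by_contra hfe
        exact h0.le ⟨hfe, h'⟩
      rw [Finset.sum_eq_zero, Finset.sum_eq_single e, zero_sub, neg_eq_zero] at hn
      · refine hmem.1 (eq_zero_of_cauchy hs (hsol.1 e) (hsol.2.1 e) (l := 0) ?_ hn)
        rw [← hsol.vtxVal_o, hmem.2, hw0]
      · exact fun e' h' hne => hdz _ _ (huniq e' (Finset.mem_filter.1 h').2 hne)
      · exact fun h' => absurd (Finset.mem_filter.2 ⟨Finset.mem_univ e, hmem.2⟩) h'
      · exact fun e' h' => hdz _ _ (hnone e' (Finset.mem_filter.1 h').2)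
  by_cases hv : G.IsProperCoreVertex v
  · exact hB v (hcore v hv)
  · rw [IsProperCoreVertex] at hv
    push Not at hv
    obtain ⟨e, he, hec⟩ := hv
    exact hinc v e he (by_contra fun h => hec (hsupp h))

/-- Under the Betti number condition, an eigenfunction vanishing at all vertices vanishes. -/
lemma InKer.eq_zero_of_vtxVal (hlam : 0 < lam) (hf : G.InKer lam f)
    (hbetti : G.beta1 (G.lamEdges lam) = (G.beta0odd (G.lamEdges lam) (π / Real.sqrt lam) : ℤ))
    (h0 : ∀ v, G.vtxVal f v = 0) : f = 0 := by
  have hsol := hf.isSol_sqrt hlam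
  have hs := ofReal_sqrt_ne_zero hlam
  have hsqrt := Real.sqrt_pos.2 hlam
  have hx : 0 < π / Real.sqrt lam := div_pos Real.pi_pos hsqrt
  let b : G.E → ℂ := fun e => deriv (f e) 0 / (Real.sqrt lam : ℂ)
  have hfb : ∀ e, f e = trig (Real.sqrt lam) 0 (b e) := fun e => by
    have := hsol.eq_trig hs e
    rwa [← hsol.vtxVal_o, h0] at this
  suffices b = 0 by
    funext e x
    rw [hfb, this]
    simp [trig]
  have hk : ∀ e, ∃ k : ℕ, e ∈ G.lamEdges lam → G.L e = k * (π / Real.sqrt lam) := fun e => by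
    by_cases he : e ∈ G.lamEdges lam
    · obtain ⟨k, -, h⟩ := he
      exact ⟨k, fun _ => h⟩
    · exact ⟨0, fun h => absurd h he⟩
  choose k hk using hk
  have hb : ∀ e, e ∉ G.lamEdges lam → b e = 0 := fun e he => by
    by_contra hbe
    have h1 : f e (G.L e) = 0 := by rw [← hsol.vtxVal_t, h0]
    rw [hfb] at h1
    simp only [trig, zero_mul, zero_add, mul_eq_zero, hbe, false_or] at h1
    rw [← Complex.ofReal_mul, ← Complex.ofReal_sin, Complex.ofReal_eq_zero,
      Real.sin_eq_zero_iff] at h1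
    obtain ⟨n, hn⟩ := h1
    have hpos : 0 < (n : ℝ) := by
      have : 0 < (n : ℝ) * π := hn ▸ mul_pos hsqrt (G.L_pos e)
      exact pos_of_mul_pos_left this Real.pi_pos.le
    have hn0 : 0 < n := by exact_mod_cast hpos
    refine he ⟨n.toNat, by omega, ?_⟩
    have : ((n.toNat : ℕ) : ℝ) = n := by exact_mod_cast Int.toNat_of_nonneg hn0.le
    rw [this]
    field_simp
    linarith
  refine eq_zero_of_betti hx hk hbetti hb fun v => ?_
  have hcos : ∀ e, Complex.cos (Real.sqrt lam * G.L e) * b e = (-1) ^ k e * b e := fun e => by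
    by_cases he : e ∈ G.lamEdges lam
    · have : Real.sqrt lam * G.L e = k e * π := by
        rw [hk e he]
        field_simp
      rw [← Complex.ofReal_mul, this, ← Complex.ofReal_cos, Real.cos_nat_mul_pi]
      simp
    · simp [hb e he]
  have hn := hf.2 v
  simp only [normDer, hfb, deriv_trig, trig, Complex.ofReal_zero, mul_zero, Complex.cos_zero,
    Complex.sin_zero, mul_one, neg_zero, zero_mul, add_zero] at hn
  rw [← Finset.mul_sum, ← Finset.mul_sum, ← mul_sub, mul_eq_zero] at hn
  rw [← sub_eq_zero.1 (hn.resolve_left hs)]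
  exact Finset.sum_congr rfl fun e _ => by rw [← hcos, mul_comm]

end Vanishing

end MetricGraph

section MatrixPole

variable {m : Type} {M : ℂ → Matrix m m ℂ} {Y : m → m → ℂ → ℂ} {a : ℂ}

/-- A matrix function with an at most simple pole, written as `(z - a)⁻¹ Y(z)`, has a pole
precisely when `Y(a)` does not vanish. -/
lemma isPole_iff_of_simple [Fintype m] (hY : ∀ k l, AnalyticAt ℂ (Y k l) a)
    (hM : ∀ᶠ z in 𝓝[≠] a, ∀ k l, M z k l = (z - a)⁻¹ * Y k l z) :
    isPole M a ↔ (Matrix.of fun k l => Y k l a) ≠ 0 := by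
  have hlim : Tendsto (fun z => (z - a) • M z) (𝓝[≠] a) (𝓝 (Matrix.of fun k l => Y k l a)) := by
    refine tendsto_pi_nhds.2 fun k => tendsto_pi_nhds.2 fun l => ?_
    refine ((hY k l).continuousAt.tendsto.mono_left nhdsWithin_le_nhds).congr' ?_
    filter_upwards [hM, self_mem_nhdsWithin] with z hz hne
    change Y k l z = (z - a) * M z k l
    rw [hz, mul_inv_cancel_left₀ (sub_ne_zero.2 hne)]
  have hsub : ∀ n : ℕ, Tendsto (fun z : ℂ => (z - a) ^ (n + 1)) (𝓝[≠] a) (𝓝 0) := fun n => by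
    have : ContinuousAt (fun z : ℂ => (z - a) ^ (n + 1)) a := by fun_prop
    simpa using this.tendsto.mono_left nhdsWithin_le_nhds
  constructor
  · rintro ⟨-, n, hn, ⟨A, hA, hAlim⟩, -⟩ h0
    rw [h0] at hlim
    refine hA (tendsto_nhds_unique hAlim ?_)
    obtain ⟨n, rfl⟩ := Nat.exists_eq_add_of_le' hn
    have hc : Tendsto (fun z : ℂ => (z - a) ^ n) (𝓝[≠] a) (𝓝 ((a - a) ^ n)) :=
      (by fun_prop : ContinuousAt (fun z : ℂ => (z - a) ^ n) a).tendsto.mono_left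
        nhdsWithin_le_nhds
    have := hc.smul hlim
    rw [smul_zero] at this
    refine this.congr fun z => ?_
    rw [smul_smul, pow_succ]
  · intro hne
    refine ⟨?_, 1, le_rfl, ⟨_, hne, by simpa using hlim⟩, ?_⟩
    · have h1 : ∀ᶠ z in 𝓝[≠] a, ∀ k l, AnalyticAt ℂ (Y k l) z :=
        nhdsWithin_le_nhds (eventually_all.2 fun k => eventually_all.2 fun l =>
          (hY k l).eventually_analyticAt)
      filter_upwards [h1, eventually_eventually_nhdsWithin.2 hM, self_mem_nhdsWithin]
        with z hz hMz hza k l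
      rw [isOpen_compl_singleton.nhdsWithin_eq hza] at hMz
      have h2 : AnalyticAt ℂ (fun w => (w - a)⁻¹ * Y k l w) z :=
        ((analyticAt_id.sub analyticAt_const).inv (sub_ne_zero.2 hza)).mul (hz k l)
      exact h2.congr (hMz.mono fun w hw => (hw k l).symm)
    · have := (hsub 0).smul hlim
      rw [zero_smul] at this
      refine this.congr fun z => ?_
      rw [smul_smul, ← pow_succ]

/-- The residue of a matrix function with an at most simple pole. -/
lemma matResidue_of_simple (hY : ∀ k l, AnalyticAt ℂ (Y k l) a)
    (hM : ∀ᶠ z in 𝓝[≠] a, ∀ k l, M z k l = (z - a)⁻¹ * Y k l z) :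
    matResidue M a = Matrix.of fun k l => Y k l a := by
  ext k l
  have key : ∀ᶠ R in 𝓝[>] (0 : ℝ),
      (2 * (π : ℂ) * Complex.I)⁻¹ * circleIntegral (fun z => M z k l) a R = Y k l a := by
    have h1 : ∀ᶠ z in 𝓝 a, DifferentiableAt ℂ (Y k l) z :=
      (hY k l).eventually_analyticAt.mono fun z hz => hz.differentiableAt
    obtain ⟨r, hr, hball⟩ := Metric.eventually_nhds_iff_ball.1
      (h1.and (eventually_nhdsWithin_iff.1 hM))
    filter_upwards [Ioo_mem_nhdsGT hr] with R hR
    have hcl : Metric.closedBall a R ⊆ Metric.ball a r := Metric.closedBall_subset_ball hR.2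
    have hd : DiffContOnCl ℂ (Y k l) (Metric.ball a R) := by
      refine DifferentiableOn.diffContOnCl fun z hz => ?_
      exact (hball z (hcl (Metric.closure_ball_subset_closedBall hz))).1.differentiableWithinAt
    have hC := hd.circleIntegral_sub_inv_smul (Metric.mem_ball_self hR.1)
    rw [circleIntegral.integral_congr (g := fun z => (z - a)⁻¹ • Y k l z) hR.1.le fun z hz => ?_,
      hC, smul_eq_mul, inv_mul_cancel_left₀ Complex.two_pi_I_ne_zero]
    have hza : z ≠ a := by
      rintro rfl
      simp only [mem_sphere_iff_norm, sub_self, norm_zero] at hz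
      exact hR.1.ne hz
    exact (hball z (hcl (Metric.sphere_subset_closedBall hz))).2 hza k l
  have hex : ∃ c : ℂ, ∀ᶠ R in 𝓝[>] (0 : ℝ),
      (2 * (π : ℂ) * Complex.I)⁻¹ * circleIntegral (fun z => M z k l) a R = c := ⟨_, key⟩
  rw [matResidue, Matrix.of_apply, Matrix.of_apply, dif_pos hex]
  obtain ⟨R, hR1, hR2⟩ := (hex.choose_spec.and key).exists
  exact hR1.symm.trans hR2

lemma matrix_rank_eq_zero_iff [Fintype m] (A : Matrix m m ℂ) : A.rank = 0 ↔ A = 0 := by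
  classical
  rw [Matrix.rank, Submodule.finrank_eq_zero, LinearMap.range_eq_bot, ← Matrix.toLin'_apply',
    map_eq_zero_iff _ (Matrix.toLin' (R := ℂ)).injective]

end MatrixPole

namespace MetricGraph

variable {G : MetricGraph} {lam : ℝ}

section Linear

variable {mu : ℂ} {f g : G.E → ℝ → ℂ}

lemma vtxVal_add (f g : G.E → ℝ → ℂ) (v : G.V) :
    G.vtxVal (f + g) v = G.vtxVal f v + G.vtxVal g v := by
  simp only [vtxVal]
  split_ifs <;> rfl

lemma vtxVal_smul (c : ℂ) (f : G.E → ℝ → ℂ) (v : G.V) :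
    G.vtxVal (c • f) v = c * G.vtxVal f v := by
  simp only [vtxVal]
  split_ifs <;> rfl

lemma deriv_add_edge (hf : G.IsSol mu f) (hg : G.IsSol mu g) (e : G.E) :
    deriv ((f + g) e) = deriv (f e) + deriv (g e) :=
  funext fun x => (((hf.1 e).hasDerivAt_of_two x).add ((hg.1 e).hasDerivAt_of_two x)).deriv

lemma deriv_smul_edge (c : ℂ) (hf : G.IsSol mu f) (e : G.E) :
    deriv ((c • f) e) = c • deriv (f e) :=
  funext fun x => (((hf.1 e).hasDerivAt_of_two x).const_smul c).deriv

lemma IsSol.add (hf : G.IsSol mu f) (hg : G.IsSol mu g) : G.IsSol mu (f + g) := by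
  refine ⟨fun e => (hf.1 e).add (hg.1 e), fun e x => ?_,
    contVert_of_vertex (u := fun v => G.vtxVal f v + G.vtxVal g v) (fun e => ?_) fun e => ?_⟩
  · rw [deriv_add_edge hf hg,
      (((hf.1 e).hasDerivAt_deriv_of_two x).add ((hg.1 e).hasDerivAt_deriv_of_two x)).deriv,
      hf.2.1, hg.2.1]
    simp only [Pi.add_apply]; ring
  · rw [hf.vtxVal_o, hg.vtxVal_o]; rfl
  · rw [hf.vtxVal_t, hg.vtxVal_t]; rfl

lemma IsSol.smul (c : ℂ) (hf : G.IsSol mu f) : G.IsSol mu (c • f) := by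
  refine ⟨fun e => (hf.1 e).const_smul c, fun e x => ?_,
    contVert_of_vertex (u := fun v => c * G.vtxVal f v) (fun e => ?_) fun e => ?_⟩
  · rw [deriv_smul_edge c hf, (((hf.1 e).hasDerivAt_deriv_of_two x).const_smul c).deriv, hf.2.1]
    simp only [Pi.smul_apply, smul_eq_mul]; ring
  · rw [hf.vtxVal_o]; rfl
  · rw [hf.vtxVal_t]; rfl

lemma IsSol.zero : G.IsSol mu 0 :=
  ⟨fun e => contDiff_const, fun e x => by simp,
    fun _ _ _ => rfl, fun _ _ _ => rfl, fun _ _ _ => rfl⟩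

variable (G lam) in
/-- The eigenspace `ker (-Δ_G - λ)` as a subspace. -/
def kerSub : Submodule ℂ (G.E → ℝ → ℂ) where
  carrier := G.kerSet lam
  add_mem' {f g} hf hg := ⟨hf.1.add hg.1, fun v => by
    have h := congrArg₂ (· + ·) (hf.2 v) (hg.2 v)
    simp only [normDer] at h ⊢
    rw [Finset.sum_congr rfl fun e _ => congrFun (deriv_add_edge hf.1 hg.1 e) (G.L e),
      Finset.sum_congr rfl fun e _ => congrFun (deriv_add_edge hf.1 hg.1 e) 0]
    simp only [Pi.add_apply, Finset.sum_add_distrib]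
    linear_combination h⟩
  zero_mem' := ⟨IsSol.zero, fun v => by simp [normDer]⟩
  smul_mem' c f hf := ⟨hf.1.smul c, fun v => by
    have h := congrArg (c * ·) (hf.2 v)
    simp only [normDer] at h ⊢
    rw [Finset.sum_congr rfl fun e _ => congrFun (deriv_smul_edge c hf.1 e) (G.L e),
      Finset.sum_congr rfl fun e _ => congrFun (deriv_smul_edge c hf.1 e) 0]
    simp only [Pi.smul_apply, smul_eq_mul, ← Finset.mul_sum]
    linear_combination h⟩

variable (G lam) in
lemma dimKer_eq : G.dimKer lam = Module.finrank ℂ (G.kerSub lam) := by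
  rw [dimKer, show G.kerSet lam = (G.kerSub lam : Set (G.E → ℝ → ℂ)) from rfl, Submodule.span_eq]

variable (G lam) in
lemma isEigenvalue_iff : G.IsEigenvalue lam ↔ G.kerSub lam ≠ ⊥ := by
  rw [IsEigenvalue, show G.kerSet lam = (G.kerSub lam : Set (G.E → ℝ → ℂ)) from rfl, Ne, Ne,
    ← Submodule.bot_coe (R := ℂ), SetLike.coe_set_eq]

lemma pair_comm (f g : G.E → ℝ → ℂ) : pair f g = pair g f := by
  simp only [pair, mul_comm]

lemma pair_add_left {h : G.E → ℝ → ℂ} (hf : ∀ e, Continuous (f e)) (hg : ∀ e, Continuous (g e))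
    (hh : ∀ e, Continuous (h e)) : pair (f + g) h = pair f h + pair g h := by
  rw [pair, pair, pair, ← Finset.sum_add_distrib]
  refine Finset.sum_congr rfl fun e _ => ?_
  simp only [Pi.add_apply, add_mul]
  exact intervalIntegral.integral_add (((hf e).mul (hh e)).intervalIntegrable _ _)
    (((hg e).mul (hh e)).intervalIntegrable _ _)

lemma pair_smul_left (c : ℂ) (f h : G.E → ℝ → ℂ) : pair (c • f) h = c * pair f h := by
  rw [pair, pair, Finset.mul_sum]
  refine Finset.sum_congr rfl fun e _ => ?_
  rw [← intervalIntegral.integral_const_mul]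
  simp only [Pi.smul_apply, smul_eq_mul, mul_assoc]

lemma continuous_of_mem_kerSub (f : G.kerSub lam) (e : G.E) : Continuous (f.1 e) :=
  (f.2.1.1 e).continuous

variable (G lam) in
/-- The bilinear `L²` pairing on the eigenspace. -/
def kerPair : G.kerSub lam →ₗ[ℂ] G.kerSub lam →ₗ[ℂ] ℂ :=
  LinearMap.mk₂ ℂ (fun f g => pair f.1 g.1)
    (fun f g h => pair_add_left (continuous_of_mem_kerSub f) (continuous_of_mem_kerSub g)
      (continuous_of_mem_kerSub h))
    (fun c f g => pair_smul_left c f.1 g.1)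
    (fun f g h => by
      rw [pair_comm f.1, pair_comm f.1, pair_comm f.1]
      exact pair_add_left (continuous_of_mem_kerSub g) (continuous_of_mem_kerSub h)
        (continuous_of_mem_kerSub f))
    (fun c f g => by
      rw [pair_comm f.1, pair_comm f.1]
      exact pair_smul_left c g.1 f.1)

lemma kerPair_injective (hlam : 0 < lam) : Function.Injective (kerPair G lam) := by
  rw [injective_iff_map_eq_zero]
  intro f hf
  have h := LinearMap.congr_fun hf ⟨conj f.1, InKer.conj f.2⟩
  exact Subtype.ext ((InKer.isSol_sqrt hlam f.2).eq_zero_of_pair_conj (ofReal_sqrt_ne_zero hlam) h)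

variable (lam) in
/-- The trace of an eigenfunction on the vertex set `B`. -/
def kerTrace (B : Finset G.V) : G.kerSub lam →ₗ[ℂ] (B → ℂ) where
  toFun f v := G.vtxVal f.1 v
  map_add' f g := funext fun v => vtxVal_add f.1 g.1 v
  map_smul' c f := funext fun v => vtxVal_smul c f.1 v

/-- Elements of the eigenspace representing the evaluations at the vertices of `B` span the
eigenspace if the trace on `B` is injective. -/
lemma span_eq_top_of_kerTrace_injective {B : Finset G.V} (hlam : 0 < lam)
    (hinj : Function.Injective (kerTrace lam B)) {h : B → G.kerSub lam}
    (hh : ∀ l g, kerPair G lam (h l) g = -G.vtxVal g.1 l) :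
    Submodule.span ℂ (Set.range h) = ⊤ := by
  have : Module.Finite ℂ (G.kerSub lam) := Module.Finite.of_injective _ hinj
  by_contra hne
  obtain ⟨φ, hφ, hle⟩ := Submodule.exists_le_ker_of_lt_top _ (lt_top_iff_ne_top.2 hne)
  have hbij : Function.Surjective (kerPair G lam) :=
    (LinearMap.injective_iff_surjective_of_finrank_eq_finrank
      Subspace.dual_finrank_eq.symm).1 (kerPair_injective hlam)
  obtain ⟨g, rfl⟩ := hbij φ
  refine hφ ?_
  suffices g = 0 by rw [this, map_zero]
  apply hinj
  rw [map_zero]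
  funext l
  have h1 : kerPair G lam g (h l) = 0 := hle (Submodule.subset_span ⟨l, rfl⟩)
  have h2 : kerPair G lam (h l) g = 0 := (pair_comm _ _).trans h1
  rw [hh, neg_eq_zero] at h2
  exact h2

end Linear

/-- Away from the pole, the entries of the Titchmarsh--Weyl matrix are the vertex values of the
analytic families of solutions. -/
lemma eventually_TW_eq (hlam : 0 < lam) (B : Finset G.V) {y : G.V → ℂ → G.Idx → ℂ}
    (hy : ∀ v, ∀ᶠ z in 𝓝 (lam : ℂ),
      G.sysMap (rt z) (y v z) = (z - lam) • rhs (Pi.single v 1)) :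
    ∀ᶠ z in 𝓝[≠] (lam : ℂ), ∀ k l : B,
      G.TW B z k l = (z - lam)⁻¹ * y l z (.inr (.inr k)) := by
  filter_upwards [eventually_det_ne_zero G hlam, nhdsWithin_le_nhds (eventually_all.2 hy),
    nhdsWithin_le_nhds (eventually_ne_zero hlam), self_mem_nhdsWithin] with z hdet hz hz0 hzl k l
  have hne : z - lam ≠ 0 := sub_ne_zero.2 hzl
  have hx : G.sysMap (rt z) ((z - lam)⁻¹ • y l z) = rhs (Pi.single (l : G.V) 1) := by
    rw [map_smul, hz, inv_smul_smul₀ hne]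
  have hnd : ∀ f, G.IsTWsol z l f → G.normDer f = Pi.single (l : G.V) 1 := fun f hf => by
    funext w
    by_cases hw : w = l
    · rw [hw, hf.2.1, Pi.single_eq_same]
    · rw [hf.2.2 w hw, Pi.single_eq_of_ne hw]
  have hex : ∃ f, G.IsTWsol z l f := by
    obtain ⟨hsol, hn, -⟩ := isSol_solFun hx
    rw [rt_sq hz0] at hsol
    exact ⟨_, hsol, by rw [hn, Pi.single_eq_same], fun w hw => by rw [hn, Pi.single_eq_of_ne hw]⟩
  rw [TW, Matrix.of_apply, dif_pos hex]
  have hf := hex.choose_spec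
  have hsol : G.IsSol (rt z ^ 2) hex.choose := by
    have := hf.1
    generalize hex.choose = f at this
    rwa [rt_sq hz0]
  have hc := sysMap_coef (rt_ne_zero z) hsol
  rw [hnd _ hf, ← hx, ← sub_eq_zero, ← map_sub, ← sysMat_mulVec] at hc
  exact congrFun (sub_eq_zero.1 (Matrix.eq_zero_of_mulVec_eq_zero hdet hc)) (.inr (.inr k))

end MetricGraph


/-- Theorem `thm:visibility` (i): if `B` contains all boundary
vertices and all proper core vertices, `λ > 0`, and `β₁(G_λ) = β₀^odd(G_λ)`, then `λ`
is an eigenvalue of `-Δ_G` iff `λ` is a pole of `M_B`, and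
`dim ker(-Δ_G - λ) = rank Res_λ M_B`. -/
theorem statement_13 (G : MetricGraph) (B : Finset G.V)
    (hbd : ∀ v, G.IsBoundaryVertex v → v ∈ B)
    (hcore : ∀ v, G.IsProperCoreVertex v → v ∈ B)
    (lam : ℝ) (hlam : 0 < lam)
    (hbetti : G.beta1 (G.lamEdges lam) =
      (G.beta0odd (G.lamEdges lam) (π / Real.sqrt lam) : ℤ)) :
    (G.IsEigenvalue lam ↔ isPole (G.TW B) (lam : ℂ)) ∧
    G.dimKer lam = (matResidue (G.TW B) (lam : ℂ)).rank := by
  have hinj : Function.Injective (MetricGraph.kerTrace lam B) := by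
    rw [injective_iff_map_eq_zero]
    refine fun f hf => Subtype.ext (MetricGraph.InKer.eq_zero_of_vtxVal hlam f.2 hbetti fun v => ?_)
    exact MetricGraph.InKer.vtxVal_eq_zero hbd hcore hlam f.2 (fun v hv => congrFun hf ⟨v, hv⟩) v
  choose y hy hfam using MetricGraph.exists_family G hlam
  have hfam' : ∀ v, ∀ᶠ z in 𝓝 (lam : ℂ), G.sysMap (MetricGraph.rt z) (y v z) =
      (z - lam) ^ (0 + 1) • MetricGraph.rhs (Pi.single v 1) := fun v => by simpa using hfam v
  have hker := fun v => MetricGraph.inKer_of_family hlam (hfam' v)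
  let h : B → G.kerSub lam := fun l => ⟨_, (hker l).2⟩
  have hspan := MetricGraph.span_eq_top_of_kerTrace_injective hlam hinj (h := h) fun l g => by
    have := MetricGraph.pair_of_family hlam (hy l) (hfam' l) g.2
    rwa [pow_zero, one_mul] at this
  let Y : B → B → ℂ → ℂ := fun k l z => y l z (.inr (.inr k))
  have hY : ∀ k l, AnalyticAt ℂ (Y k l) lam := fun k l => analyticAt_pi_iff.1 (hy l) _
  have hTW := MetricGraph.eventually_TW_eq hlam B hfam
  have hres := matResidue_of_simple (M := G.TW B) (Y := Y) hY hTW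
  have hdim : G.dimKer lam = (matResidue (G.TW B) (lam : ℂ)).rank := by
    have hcol : Set.range (Matrix.of fun k l => Y k l lam).col =
        MetricGraph.kerTrace lam B '' Set.range h := by
      rw [← Set.range_comp]
      congr 1
      funext l k
      exact ((MetricGraph.isSol_solFun (hker l).1).2.2 k).symm
    rw [hres, Matrix.rank_eq_finrank_span_cols, hcol, Submodule.span_image, hspan,
      Submodule.map_top, LinearMap.finrank_range_of_inj hinj, MetricGraph.dimKer_eq]
  refine ⟨?_, hdim⟩
  have : Module.Finite ℂ (G.kerSub lam) := Module.Finite.of_injective _ hinj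
  rw [isPole_iff_of_simple hY hTW, ← hres, MetricGraph.isEigenvalue_iff, not_iff_not,
    ← Submodule.finrank_eq_zero (R := ℂ), ← MetricGraph.dimKer_eq, hdim, matrix_rank_eq_zero_iff]
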